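/- arXiv:2604.18042 — 2 statements merged into one kernel-verified Lean document; each statement's English description precedes it below -/
import Mathlib

section
/- Cone membership of the adaptive elastic-net error: let y = Xβ* + ε, let β̂ be a global minimizer of the adaptive elastic-net objective with weights P_{1,j} = ξ₀(1 − p_j)K_{ii} and P_{2,j} = p_j K_{ii}²/(2σ₁²), and set δ = β̂ − β*. Suppose β* has support S with max_{j∈S}|β*_j| ≤ B, that p̄ = max_{j∉S} p_j < 1/2 and p̲ = min_{j∈S} p_j, that the noise satisfies the deterministic bound ‖Xᵀε‖_∞ ≤ ξ₀/2 (using σ_i² K_{ii} = 1), and that ξ₀ ≥ B K_{ii}/σ₁². Then the error vector lies in the cone ‖δ_{S^c}‖₁ ≤ L ‖δ_S‖₁ with L = (5 − 2p̲)/(1 − 2p̄). -/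
open Finset

noncomputable section

/-- The adaptive elastic-net objective with weights
`P₁_j = ξ₀(1 − p_j)K_ii` and `P₂_j = p_j K_ii²/(2σ₁²)`. -/
def adaptiveEnetObj {n q : ℕ} (σi2 σ1 ξ0 Kii : ℝ) (pw : Fin q → ℝ)
    (X : Matrix (Fin n) (Fin q) ℝ) (y : Fin n → ℝ) (β : Fin q → ℝ) : ℝ :=
  (1 / (2 * σi2)) * ∑ i, (y i - (X.mulVec β) i) ^ 2
    + ∑ j, (ξ0 * (1 - pw j) * Kii) * |β j|
    + ∑ j, (pw j * Kii ^ 2 / (2 * σ1 ^ 2)) * (β j) ^ 2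

/-- **Cone membership of the adaptive elastic-net error.**  Under the deterministic noise
bound `‖Xᵀε‖_∞ ≤ ξ₀/2` (with `σ_i² K_ii = 1`), the condition `ξ₀ ≥ B K_ii/σ₁²`, support
`S` with signal bound `B`, and weight separation `p̄ = max_{j∉S} p_j < 1/2`,
`p̲ = min_{j∈S} p_j`, the error `δ = β̂ − β*` of any global minimizer `β̂` satisfies
`‖δ_{S^c}‖₁ ≤ L‖δ_S‖₁` with `L = (5 − 2p̲)/(1 − 2p̄)`. -/
theorem cone_membership_adaptive_elastic_net
    (n p : ℕ) (σi2 σ1 ξ0 Kii B : ℝ)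
    (hσi2 : 0 < σi2) (hσ1 : 0 < σ1) (hξ0 : 0 < ξ0) (hB : 0 < B)
    (hKii : Kii = 1 / σi2) (hnorm : σi2 * Kii = 1)
    (pw : Fin (p - 1) → ℝ) (hpw : ∀ j, pw j ∈ Set.Icc (0 : ℝ) 1)
    (X : Matrix (Fin n) (Fin (p - 1)) ℝ) (βstar : Fin (p - 1) → ℝ) (ε : Fin n → ℝ)
    (y : Fin n → ℝ) (hy : y = X.mulVec βstar + ε)
    (S : Finset (Fin (p - 1))) (hS : ∀ j, j ∈ S ↔ βstar j ≠ 0)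
    (hsignal : ∀ j ∈ S, |βstar j| ≤ B)
    (pbar plow : ℝ)
    (hpbar : IsGreatest (pw '' {j | j ∉ S}) pbar)
    (hplow : IsLeast (pw '' {j | j ∈ S}) plow)
    (hpbar_half : pbar < 1 / 2)
    (hnoise : ∀ j, |∑ i, X i j * ε i| ≤ ξ0 / 2)
    (hξ0B : B * Kii / σ1 ^ 2 ≤ ξ0)
    (βhat : Fin (p - 1) → ℝ)
    (hmin : ∀ β : Fin (p - 1) → ℝ,
      adaptiveEnetObj σi2 σ1 ξ0 Kii pw X y βhat ≤ adaptiveEnetObj σi2 σ1 ξ0 Kii pw X y β) :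
    ∑ j ∈ Sᶜ, |(βhat - βstar) j|
      ≤ (5 - 2 * plow) / (1 - 2 * pbar) * ∑ j ∈ S, |(βhat - βstar) j| := by
  have hK : 0 < Kii := by rw [hKii]; positivity
  have h0 := hmin βstar
  have hKs : 1 / (2 * σi2) = Kii / 2 := by rw [hKii]; field_simp
  have hlin : ∀ i, (X.mulVec βhat) i = (X.mulVec βstar) i + (X.mulVec (βhat - βstar)) i := by
    intro i
    rw [Matrix.mulVec_sub]; simp
  have hq : ∑ i, ε i * (X.mulVec (βhat - βstar)) i
      = ∑ j, (∑ i, X i j * ε i) * (βhat j - βstar j) := by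
    simp only [Matrix.mulVec, dotProduct, Finset.mul_sum, Finset.sum_mul]
    rw [Finset.sum_comm]
    refine Finset.sum_congr rfl fun j _ => Finset.sum_congr rfl fun i _ => ?_
    simp only [Pi.sub_apply]; ring
  have hloss : ∑ i, (y i - (X.mulVec βstar) i) ^ 2 - 2 * ∑ i, ε i * (X.mulVec (βhat - βstar)) i
      ≤ ∑ i, (y i - (X.mulVec βhat) i) ^ 2 := by
    rw [Finset.mul_sum, ← Finset.sum_sub_distrib]
    refine Finset.sum_le_sum fun i _ => ?_
    rw [hlin i, hy]
    simp only [Pi.add_apply]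
    nlinarith [sq_nonneg ((X.mulVec (βhat - βstar)) i)]
  set c : ℝ := Kii / (2 * σ1 ^ 2) with hc
  have hc0 : 0 < c := by positivity
  have hcB : 2 * (c * B) ≤ ξ0 := by
    refine le_trans (le_of_eq ?_) hξ0B
    rw [hc]; field_simp
  let t : Fin (p - 1) → ℝ := fun j => -((∑ i, X i j * ε i) * (βhat j - βstar j))
    + ξ0 * (1 - pw j) * (|βhat j| - |βstar j|) + pw j * c * (βhat j ^ 2 - βstar j ^ 2)
  have ht : ∑ j, t j ≤ 0 := by
    have hsum : Kii * ∑ j, t j = -(Kii * ∑ i, ε i * (X.mulVec (βhat - βstar)) i)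
        + (∑ j, (ξ0 * (1 - pw j) * Kii) * |βhat j| - ∑ j, (ξ0 * (1 - pw j) * Kii) * |βstar j|)
        + (∑ j, (pw j * Kii ^ 2 / (2 * σ1 ^ 2)) * (βhat j) ^ 2
          - ∑ j, (pw j * Kii ^ 2 / (2 * σ1 ^ 2)) * (βstar j) ^ 2) := by
      rw [hq, Finset.mul_sum, Finset.mul_sum, ← Finset.sum_neg_distrib, ← Finset.sum_sub_distrib,
        ← Finset.sum_sub_distrib, ← Finset.sum_add_distrib, ← Finset.sum_add_distrib]
      refine Finset.sum_congr rfl fun j _ => ?_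
      simp only [t, hc]; ring
    unfold adaptiveEnetObj at h0
    rw [hKs] at h0
    have h1 := mul_le_mul_of_nonneg_left hloss (by positivity : 0 ≤ Kii / 2)
    have h2 : Kii * ∑ j, t j ≤ 0 := by rw [hsum]; linarith
    by_contra h
    push Not at h
    nlinarith [mul_pos hK h]
  have hnz : ∀ j, -((∑ i, X i j * ε i) * (βhat j - βstar j)) ≥ -(ξ0 / 2 * |βhat j - βstar j|) := by
    intro j
    have h1 := le_abs_self ((∑ i, X i j * ε i) * (βhat j - βstar j))
    rw [abs_mul] at h1
    have h2 := mul_le_mul_of_nonneg_right (hnoise j) (abs_nonneg (βhat j - βstar j))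
    linarith
  have hin : ∀ j ∈ S, -(3 / 2 * ξ0) * |βhat j - βstar j| ≤ t j := by
    intro j hj
    obtain ⟨hp0, hp1⟩ := hpw j
    have h1 : -|βhat j - βstar j| ≤ |βhat j| - |βstar j| := by
      have := abs_sub_abs_le_abs_sub (βstar j) (βhat j)
      rw [abs_sub_comm] at this; linarith
    have h2 := mul_le_mul_of_nonneg_left h1 (by nlinarith : 0 ≤ ξ0 * (1 - pw j))
    have h3 : -(2 * B * |βhat j - βstar j|) ≤ βhat j ^ 2 - βstar j ^ 2 := by
      have h4 := neg_abs_le (βstar j * (βhat j - βstar j))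
      rw [abs_mul] at h4
      have h5 := mul_le_mul_of_nonneg_right (hsignal j hj) (abs_nonneg (βhat j - βstar j))
      nlinarith [sq_nonneg (βhat j - βstar j)]
    have h6 := mul_le_mul_of_nonneg_left h3 (by positivity : 0 ≤ pw j * c)
    have h7 := mul_le_mul_of_nonneg_left hcB (mul_nonneg hp0 (abs_nonneg (βhat j - βstar j)))
    have h8 := hnz j
    simp only [t]
    linarith
  have hout : ∀ j ∈ Sᶜ, ξ0 * (1 / 2 - pbar) * |βhat j - βstar j| ≤ t j := by
    intro j hj
    have hjS : j ∉ S := by simpa using hj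
    obtain ⟨hp0, hp1⟩ := hpw j
    have hpb : pw j ≤ pbar := hpbar.2 ⟨j, hjS, rfl⟩
    have hz : βstar j = 0 := by
      by_contra h
      exact hjS ((hS j).2 h)
    have h8 := hnz j
    simp only [t]
    rw [hz] at h8 ⊢
    simp only [sub_zero, abs_zero] at h8 ⊢
    have h9 : 0 ≤ pw j * c * (βhat j ^ 2 - 0 ^ 2) := by
      have : βhat j ^ 2 - 0 ^ 2 = βhat j ^ 2 := by ring
      rw [this]; positivity
    have h10 := mul_le_mul_of_nonneg_left hpb (mul_nonneg hξ0.le (abs_nonneg (βhat j)))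
    linarith
  have hA := Finset.sum_le_sum hin
  have hC := Finset.sum_le_sum hout
  rw [← Finset.mul_sum] at hA hC
  rw [← Finset.sum_add_sum_compl S t] at ht
  simp only [Pi.sub_apply]
  have hN : 0 ≤ ∑ j ∈ S, |βhat j - βstar j| := Finset.sum_nonneg fun j _ => abs_nonneg _
  have hpl : plow ≤ 1 := by
    obtain ⟨j, _, hj⟩ := hplow.1
    rw [← hj]; exact (hpw j).2
  generalize ∑ j ∈ S, |βhat j - βstar j| = a at *
  generalize ∑ j ∈ Sᶜ, |βhat j - βstar j| = b at *
  have hk : ξ0 * ((1 - 2 * pbar) * b) ≤ ξ0 * (3 * a) := by linarith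
  have hk2 := le_of_mul_le_mul_left hk hξ0
  rw [div_mul_eq_mul_div, le_div_iff₀ (by linarith)]
  nlinarith
end
end

section
/- Deterministic ℓ₁-error bound on the good noise event: let y = Xβ* + ε, let β̂ be a global minimizer of the adaptive elastic-net objective with weights P_{1,j} = ξ₀(1 − p_j)K_{ii} and P_{2,j} = p_j K_{ii}²/(2σ₁²), and set δ = β̂ − β*. Suppose β* has support S of size s with max_{j∈S}|β*_j| ≤ B, that p̄ = max_{j∉S} p_j < 1/2 and p̲ = min_{j∈S} p_j, that ‖Xᵀε‖_∞ ≤ ξ₀/2, that ξ₀ ≥ B K_{ii}/σ₁², and that the compatibility condition holds for X with constant φ > 0 over the cone {δ : ‖δ_{S^c}‖₁ ≤ L‖δ_S‖₁} with L = (5 − 2p̲)/(1 − 2p̄). Then ‖β̂ − β*‖₁ ≤ C · s ξ₀ / n, where C > 0 is a constant depending only on φ, p̲ and p̄ (one may take C = 2(1 + L)((1 + L)/2 + 2 − p̲)/φ²). -/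
open Finset

noncomputable section

set_option maxHeartbeats 1000000 in
/-- **Deterministic ℓ₁-error bound on the good noise event.**  Under the noise bound
`‖Xᵀε‖_∞ ≤ ξ₀/2`, the condition `ξ₀ ≥ B K_ii/σ₁²`, weight separation `p̄ < 1/2`, and the
compatibility condition with constant `φ > 0` over the cone with constant
`L = (5 − 2p̲)/(1 − 2p̄)`, any global minimizer `β̂` of the adaptive elastic-net objective
satisfies `‖β̂ − β*‖₁ ≤ C·sξ₀/n` with `C = 2(1 + L)((1 + L)/2 + 2 − p̲)/φ²`. -/
theorem deterministic_l1_error_bound_adaptive_elastic_net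
    (n p : ℕ) (hn : 0 < n) (σi2 σ1 ξ0 Kii B φ : ℝ)
    (hσi2 : 0 < σi2) (hσ1 : 0 < σ1) (hξ0 : 0 < ξ0) (hB : 0 < B) (hφ : 0 < φ)
    (hKii : Kii = 1 / σi2)
    (pw : Fin (p - 1) → ℝ) (hpw : ∀ j, pw j ∈ Set.Icc (0 : ℝ) 1)
    (X : Matrix (Fin n) (Fin (p - 1)) ℝ) (βstar : Fin (p - 1) → ℝ) (ε : Fin n → ℝ)
    (y : Fin n → ℝ) (hy : y = X.mulVec βstar + ε)
    (S : Finset (Fin (p - 1))) (hS : ∀ j, j ∈ S ↔ βstar j ≠ 0)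
    (s : ℕ) (hs : s = S.card) (hs0 : 0 < s)
    (hsignal : ∀ j ∈ S, |βstar j| ≤ B)
    (pbar plow : ℝ)
    (hpbar : IsGreatest (pw '' {j | j ∉ S}) pbar)
    (hplow : IsLeast (pw '' {j | j ∈ S}) plow)
    (hpbar_half : pbar < 1 / 2)
    (hnoise : ∀ j, |∑ i, X i j * ε i| ≤ ξ0 / 2)
    (hξ0B : B * Kii / σ1 ^ 2 ≤ ξ0)
    (hcompat : ∀ δ : Fin (p - 1) → ℝ,
      ∑ j ∈ Sᶜ, |δ j| ≤ (5 - 2 * plow) / (1 - 2 * pbar) * ∑ j ∈ S, |δ j| →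
      (n : ℝ) * φ ^ 2 / s * (∑ j ∈ S, |δ j|) ^ 2 ≤ ∑ i, (X.mulVec δ i) ^ 2)
    (βhat : Fin (p - 1) → ℝ)
    (hmin : ∀ β : Fin (p - 1) → ℝ,
      adaptiveEnetObj σi2 σ1 ξ0 Kii pw X y βhat ≤ adaptiveEnetObj σi2 σ1 ξ0 Kii pw X y β) :
    ∑ j, |βhat j - βstar j|
      ≤ (2 * (1 + (5 - 2 * plow) / (1 - 2 * pbar))
          * ((1 + (5 - 2 * plow) / (1 - 2 * pbar)) / 2 + 2 - plow) / φ ^ 2)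
        * s * ξ0 / n := by
  have hK : 0 < Kii := by rw [hKii]; positivity
  have hpl1 : plow ≤ 1 := by
    obtain ⟨j, _, hj⟩ := hplow.1
    rw [← hj]; exact (hpw j).2
  have hpb0 : 0 ≤ pbar := by
    obtain ⟨j, _, hj⟩ := hpbar.1
    rw [← hj]; exact (hpw j).1
  have hden : 0 < 1 - 2 * pbar := by linarith
  have hspos : (0 : ℝ) < s := by exact_mod_cast hs0
  have hnpos : (0 : ℝ) < n := by exact_mod_cast hn
  set L := (5 - 2 * plow) / (1 - 2 * pbar) with hL
  have hL3 : 3 ≤ L := by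
    rw [hL, le_div_iff₀ hden]; linarith
  have hLmul : L * (1 - 2 * pbar) = 5 - 2 * plow := by
    rw [hL]; field_simp
  set δ : Fin (p - 1) → ℝ := fun j => βhat j - βstar j with hδ
  set c := Kii / (2 * σ1 ^ 2) with hc
  have hc0 : 0 < c := by positivity
  have hcB : 2 * c * B ≤ ξ0 := by
    have : 2 * c * B = B * Kii / σ1 ^ 2 := by rw [hc]; field_simp
    linarith
  have hobj : ∀ β, adaptiveEnetObj σi2 σ1 ξ0 Kii pw X y β
      = Kii * ((1 / 2) * ∑ i, (y i - (X.mulVec β) i) ^ 2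
        + ∑ j, (ξ0 * (1 - pw j) * |β j| + pw j * c * (β j) ^ 2)) := by
    intro β
    unfold adaptiveEnetObj
    rw [Finset.sum_add_distrib, mul_add, mul_add, Finset.mul_sum, Finset.mul_sum,
      Finset.mul_sum, Finset.mul_sum, Finset.mul_sum, add_assoc]
    congr 1
    · refine Finset.sum_congr rfl fun i _ => ?_
      rw [hKii]; field_simp
    · congr 1
      · refine Finset.sum_congr rfl fun i _ => ?_
        ring
      · refine Finset.sum_congr rfl fun i _ => ?_
        rw [hc]; field_simp
  have hb := hmin βstar
  rw [hobj, hobj] at hb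
  have hb := le_of_mul_le_mul_left hb hK
  have hres : ∑ i, (y i - (X.mulVec βhat) i) ^ 2
      = ∑ i, (y i - (X.mulVec βstar) i) ^ 2 - 2 * ∑ i, ε i * X.mulVec δ i
        + ∑ i, (X.mulVec δ i) ^ 2 := by
    rw [Finset.mul_sum, ← Finset.sum_sub_distrib, ← Finset.sum_add_distrib]
    refine Finset.sum_congr rfl fun i _ => ?_
    have h1 : X.mulVec δ i = X.mulVec βhat i - X.mulVec βstar i := by
      have : δ = βhat - βstar := rfl
      rw [this, Matrix.mulVec_sub]; rfl
    have h2 : y i = X.mulVec βstar i + ε i := by rw [hy]; rfl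
    rw [h1, h2]; ring
  have hcross : ∑ i, ε i * X.mulVec δ i = ∑ j, δ j * ∑ i, X i j * ε i := by
    simp only [Matrix.mulVec, dotProduct, Finset.mul_sum]
    rw [Finset.sum_comm]
    refine Finset.sum_congr rfl fun j _ => Finset.sum_congr rfl fun i _ => ?_
    ring
  rw [hres, hcross] at hb
  have hb2 : (1 / 2) * ∑ i, (X.mulVec δ i) ^ 2 ≤ ∑ j, (δ j * ∑ i, X i j * ε i
      + (ξ0 * (1 - pw j) * |βstar j| + pw j * c * (βstar j) ^ 2)
      - (ξ0 * (1 - pw j) * |βhat j| + pw j * c * (βhat j) ^ 2)) := by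
    rw [Finset.sum_sub_distrib, Finset.sum_add_distrib]
    linarith
  rw [← Finset.sum_add_sum_compl S] at hb2
  have hn1 : ∀ j, δ j * ∑ i, X i j * ε i ≤ ξ0 / 2 * |δ j| := by
    intro j
    calc δ j * ∑ i, X i j * ε i ≤ |δ j * ∑ i, X i j * ε i| := le_abs_self _
      _ = |∑ i, X i j * ε i| * |δ j| := by rw [abs_mul, mul_comm]
      _ ≤ _ := mul_le_mul_of_nonneg_right (hnoise j) (abs_nonneg _)
  have hSb : ∑ j ∈ S, (δ j * ∑ i, X i j * ε i
      + (ξ0 * (1 - pw j) * |βstar j| + pw j * c * (βstar j) ^ 2)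
      - (ξ0 * (1 - pw j) * |βhat j| + pw j * c * (βhat j) ^ 2))
      ≤ 3 / 2 * ξ0 * ∑ j ∈ S, |δ j| := by
    rw [Finset.mul_sum]
    refine Finset.sum_le_sum fun j hj => ?_
    have h1 := hn1 j
    have h2 : |βstar j| - |βhat j| ≤ |δ j| := by
      have := abs_sub_abs_le_abs_sub (βstar j) (βhat j)
      rwa [abs_sub_comm] at this
    have h3 : (βstar j) ^ 2 - (βhat j) ^ 2 ≤ 2 * (B * |δ j|) := by
      have e : (βstar j) ^ 2 - (βhat j) ^ 2 = -2 * (βstar j * δ j) - (δ j) ^ 2 := by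
        simp only [hδ]; ring
      have a : -(βstar j * δ j) ≤ |βstar j| * |δ j| := by
        rw [← abs_mul]; exact neg_le_abs _
      have b := mul_le_mul_of_nonneg_right (hsignal j hj) (abs_nonneg (δ j))
      linarith [sq_nonneg (δ j)]
    obtain ⟨hp0, hp1⟩ := hpw j
    have h4 := mul_le_mul_of_nonneg_left h2 (mul_nonneg hξ0.le (sub_nonneg.2 hp1))
    have h5 := mul_le_mul_of_nonneg_left h3 (mul_nonneg hp0 hc0.le)
    have h6 := mul_le_mul_of_nonneg_left hcB (mul_nonneg hp0 (abs_nonneg (δ j)))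
    linarith
  have hSc : ∑ j ∈ Sᶜ, (δ j * ∑ i, X i j * ε i
      + (ξ0 * (1 - pw j) * |βstar j| + pw j * c * (βstar j) ^ 2)
      - (ξ0 * (1 - pw j) * |βhat j| + pw j * c * (βhat j) ^ 2))
      ≤ -((1 - 2 * pbar) / 2 * ξ0) * ∑ j ∈ Sᶜ, |δ j| := by
    rw [Finset.mul_sum]
    refine Finset.sum_le_sum fun j hj => ?_
    have hjS : j ∉ S := Finset.mem_compl.1 hj
    have hz : βstar j = 0 := by
      by_contra h; exact hjS ((hS j).2 h)
    have hd : βhat j = δ j := by simp [hδ, hz]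
    have h1 := hn1 j
    have hpj : pw j ≤ pbar := hpbar.2 ⟨j, hjS, rfl⟩
    have h2 : 0 ≤ pw j * c * (δ j) ^ 2 :=
      mul_nonneg (mul_nonneg (hpw j).1 hc0.le) (sq_nonneg _)
    have h3 := mul_le_mul_of_nonneg_left hpj (mul_nonneg hξ0.le (abs_nonneg (δ j)))
    rw [hz, hd, abs_zero]
    linarith
  have hmain : ∑ i, (X.mulVec δ i) ^ 2
      ≤ ξ0 * (3 * ∑ j ∈ S, |δ j| - (1 - 2 * pbar) * ∑ j ∈ Sᶜ, |δ j|) := by linarith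
  have hXnn : 0 ≤ ∑ i, (X.mulVec δ i) ^ 2 := Finset.sum_nonneg fun i _ => sq_nonneg _
  have hcd := hcompat δ
  have hgoal : ∑ j, |βhat j - βstar j| = ∑ j ∈ S, |δ j| + ∑ j ∈ Sᶜ, |δ j| :=
    (Finset.sum_add_sum_compl S fun j => |δ j|).symm
  rw [hgoal]
  have hD : 0 ≤ ∑ j ∈ S, |δ j| := Finset.sum_nonneg fun i _ => abs_nonneg _
  have hE : 0 ≤ ∑ j ∈ Sᶜ, |δ j| := Finset.sum_nonneg fun i _ => abs_nonneg _
  generalize ∑ j ∈ S, |δ j| = D at *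
  generalize ∑ j ∈ Sᶜ, |δ j| = E at *
  generalize ∑ i, (X.mulVec δ i) ^ 2 = Q at *
  have h3 : 0 ≤ 3 * D - (1 - 2 * pbar) * E :=
    nonneg_of_mul_nonneg_right (hXnn.trans hmain) hξ0
  have hcone : E ≤ L * D := by
    refine le_of_mul_le_mul_left ?_ hden
    have : (1 - 2 * pbar) * (L * D) = (5 - 2 * plow) * D := by rw [← hLmul]; ring
    rw [this]
    have h8 : 0 ≤ (1 - plow) * D := mul_nonneg (sub_nonneg.2 hpl1) hD
    linarith
  have hcq := hcd hcone
  have hQ : Q ≤ 3 * ξ0 * D := by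
    have h9 := mul_nonneg hξ0.le (mul_nonneg hden.le hE)
    linarith
  have hDb : D ≤ 3 * (s * ξ0 / (n * φ ^ 2)) := by
    rcases hD.eq_or_lt with h0 | h0
    · rw [← h0]; positivity
    · have h7 : (n : ℝ) * φ ^ 2 / s * D ≤ 3 * ξ0 := by
        refine le_of_mul_le_mul_right ?_ h0
        calc (n : ℝ) * φ ^ 2 / s * D * D = (n : ℝ) * φ ^ 2 / s * D ^ 2 := by ring
          _ ≤ Q := hcq
          _ ≤ _ := hQ
      rw [div_mul_eq_mul_div, div_le_iff₀ hspos] at h7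
      rw [← mul_div_assoc, le_div_iff₀ (by positivity)]
      linarith
  have hW : 0 ≤ s * ξ0 / (n * φ ^ 2) := by positivity
  have hR : (2 * (1 + L) * ((1 + L) / 2 + 2 - plow) / φ ^ 2) * s * ξ0 / n
      = (1 + L) * ((5 + L - 2 * plow) * (s * ξ0 / (n * φ ^ 2))) := by
    field_simp; ring
  rw [hR]
  calc D + E ≤ (1 + L) * D := by linarith
    _ ≤ _ := by
      refine mul_le_mul_of_nonneg_left (hDb.trans ?_) (by linarith)
      exact mul_le_mul_of_nonneg_right (by linarith) hW
end
end
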